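/- arXiv:2108.07349 — 3 statements merged into one kernel-verified Lean document; each statement's English description precedes it below -/
import Mathlib

section
/- For any finite simple graph Γ, the all-ones configuration is solvable; that is, there exists x : V → ℤ/2ℤ such that N.mulVec x is the constant function 1, where N is the neighborhood matrix of Γ. -/
open scoped Classical in
/-- The neighborhood matrix of a simple graph `G` over the field `ℤ/2ℤ`:
its `(u, v)` entry is `1` if `u = v` or `u` is adjacent to `v`, and `0` otherwise. -/
noncomputable def neighborhoodMatrix {V : Type*} [Fintype V]
    (G : SimpleGraph V) : Matrix V V (ZMod 2) :=
  fun u v => if u = v ∨ G.Adj u v then 1 else 0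

/-- The quadratic form of a symmetric matrix over `ℤ/2ℤ` is the linear form given by its
diagonal. -/
lemma Matrix.IsSymm.dotProduct_mulVec_self_zmod_two {n : Type*} [Fintype n]
    {A : Matrix n n (ZMod 2)} (hA : A.IsSymm) (y : n → ZMod 2) :
    y ⬝ᵥ A.mulVec y = y ⬝ᵥ A.diag := by
  classical
  have hoff : ∑ p ∈ (Finset.univ : Finset n).offDiag, y p.1 * (A p.1 p.2 * y p.2) = 0 := by
    refine Finset.sum_involution (fun p _ => p.swap) ?_ ?_ ?_ ?_
    · intro p _
      have h : y p.2 * (A p.2 p.1 * y p.1) = y p.1 * (A p.1 p.2 * y p.2) := by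
        rw [hA.apply]
        ring
      simp only [Prod.fst_swap, Prod.snd_swap, h, CharTwo.add_self_eq_zero]
    · intro p hp _ h
      exact (Finset.mem_offDiag.mp hp).2.2 (congrArg Prod.snd h)
    · intro p hp
      simpa [eq_comm] using hp
    · intro p _
      exact p.swap_swap
  have hsq (a : ZMod 2) : a * a = a := by
    revert a
    decide
  simp only [dotProduct, Matrix.mulVec, Finset.mul_sum, Matrix.diag_apply]
  rw [← Finset.sum_product', ← Finset.diag_union_offDiag,
    Finset.sum_union (Finset.disjoint_diag_offDiag _), hoff, add_zero, Finset.sum_diag]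
  refine Finset.sum_congr rfl fun i _ => ?_
  rw [mul_left_comm, hsq, mul_comm]

/-- The diagonal of a symmetric matrix over `ℤ/2ℤ` lies in its column space. -/
lemma Matrix.IsSymm.exists_mulVec_eq_diag_zmod_two {n : Type*} [Fintype n]
    {A : Matrix n n (ZMod 2)} (hA : A.IsSymm) :
    ∃ x : n → ZMod 2, A.mulVec x = A.diag := by
  classical
  by_contra hdiag
  obtain ⟨f, hf, hker⟩ := Submodule.exists_le_ker_of_notMem
    (p := LinearMap.range A.mulVecLin) (v := A.diag) hdiag
  obtain ⟨y, rfl⟩ := (dotProductEquiv (ZMod 2) n).surjective f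
  refine hf ?_
  rw [dotProductEquiv_apply_apply, ← hA.dotProduct_mulVec_self_zmod_two]
  exact hker (LinearMap.mem_range_self A.mulVecLin y)

lemma neighborhoodMatrix_isSymm {V : Type*} [Fintype V] (G : SimpleGraph V) :
    (neighborhoodMatrix G).IsSymm := by
  classical
  exact Matrix.IsSymm.ext fun u v => if_congr (or_congr eq_comm (G.adj_comm v u)) rfl rfl

lemma neighborhoodMatrix_diag {V : Type*} [Fintype V] (G : SimpleGraph V) :
    (neighborhoodMatrix G).diag = fun _ => 1 := by
  funext v
  simp [neighborhoodMatrix]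

/-- For any finite simple graph, the all-ones configuration of Lights Out is solvable. -/
theorem allOnes_solvable {V : Type*} [Fintype V] (G : SimpleGraph V) :
    ∃ x : V → ZMod 2, (neighborhoodMatrix G).mulVec x = fun _ => 1 := by
  rw [← neighborhoodMatrix_diag G]
  exact (neighborhoodMatrix_isSymm G).exists_mulVec_eq_diag_zmod_two
end

section
/- A connected simple graph on 4 vertices is universally solvable if and only if it is isomorphic to the path graph on 4 vertices or to the cycle graph on 4 vertices. -/
/-- Lights Out on `G` is universally solvable: every configuration `b` can be obtained
by pressing some set of vertices `x`. -/
def UniversallySolvable {V : Type*} [Fintype V] (G : SimpleGraph V) : Prop :=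
  ∀ b : V → ZMod 2, ∃ x : V → ZMod 2, (neighborhoodMatrix G).mulVec x = b

theorem neighborhoodMatrix_apply {V : Type*} [Fintype V] [DecidableEq V] (G : SimpleGraph V)
    [DecidableRel G.Adj] (u v : V) :
    neighborhoodMatrix G u v = if u = v ∨ G.Adj u v then 1 else 0 := by
  simp only [neighborhoodMatrix]
  congr

theorem universallySolvable_iff_mulVec_eq_zero {V : Type*} [Fintype V] (G : SimpleGraph V) :
    UniversallySolvable G ↔ ∀ x, (neighborhoodMatrix G).mulVec x = 0 → x = 0 := by
  rw [← Matrix.ker_mulVecLin_eq_bot_iff, LinearMap.ker_eq_bot,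
    LinearMap.injective_iff_surjective]
  rfl

theorem neighborhoodMatrix_submatrix {V W : Type*} [Fintype V] [Fintype W]
    {G : SimpleGraph V} {H : SimpleGraph W} (e : G ≃g H) :
    (neighborhoodMatrix H).submatrix e e = neighborhoodMatrix G := by
  classical
  ext u v
  simp [neighborhoodMatrix_apply, e.map_adj_iff, e.injective.eq_iff]

theorem UniversallySolvable.of_iso {V W : Type*} [Fintype V] [Fintype W]
    {G : SimpleGraph V} {H : SimpleGraph W} (e : G ≃g H) (hH : UniversallySolvable H) :
    UniversallySolvable G := by
  intro b
  obtain ⟨x, hx⟩ := hH (b ∘ e.symm)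
  refine ⟨x ∘ e, ?_⟩
  have h := Matrix.submatrix_mulVec_equiv (neighborhoodMatrix H) (x ∘ e) e e.toEquiv
  have hxe : (x ∘ e) ∘ e.toEquiv.symm = x := funext fun w ↦ congrArg x (e.apply_symm_apply w)
  rw [hxe, hx] at h
  rw [← neighborhoodMatrix_submatrix e]
  exact h.trans (funext fun v ↦ congrArg b (e.symm_apply_apply v))

instance {n : ℕ} : DecidableRel (SimpleGraph.pathGraph n).Adj :=
  fun _ _ ↦ decidable_of_iff' _ SimpleGraph.pathGraph_adj

instance {n : ℕ} : DecidableRel (SimpleGraph.cycleGraph (n + 2)).Adj :=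
  fun _ _ ↦ decidable_of_iff' _ SimpleGraph.cycleGraph_adj

theorem universallySolvable_pathGraph_four :
    UniversallySolvable (SimpleGraph.pathGraph 4) := by
  rw [universallySolvable_iff_mulVec_eq_zero]
  simp only [funext_iff, Matrix.mulVec, dotProduct, neighborhoodMatrix_apply]
  decide +kernel

theorem universallySolvable_cycleGraph_four :
    UniversallySolvable (SimpleGraph.cycleGraph (2 + 2)) := by
  rw [universallySolvable_iff_mulVec_eq_zero]
  simp only [funext_iff, Matrix.mulVec, dotProduct, neighborhoodMatrix_apply]
  decide +kernel

/-- The symmetric relation on `Fin 4` with no loops and the given values at `(0, 1)`, `(0, 2)`,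
`(0, 3)`, `(1, 2)`, `(1, 3)`, `(2, 3)`. -/
def adjOfUpper (a b c d e f : Bool) : Fin 4 → Fin 4 → Bool :=
  ![![false, a, b, c], ![a, false, d, e], ![b, d, false, f], ![c, e, f, false]]

theorem exists_perm_adjOfUpper : ∀ a b c d e f : Bool,
    (∀ x : Fin 4 → ZMod 2,
      (∀ i, ∑ j, (if i = j ∨ adjOfUpper a b c d e f i j then 1 else 0) * x j = 0) →
        ∀ i, x i = 0) →
    (∀ i, ∃ j, adjOfUpper a b c d e f i j) →
    (∃ σ : Equiv.Perm (Fin 4), ∀ i j,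
      (SimpleGraph.pathGraph 4).Adj (σ i) (σ j) ↔ adjOfUpper a b c d e f i j) ∨
    ∃ σ : Equiv.Perm (Fin 4), ∀ i j,
      (SimpleGraph.cycleGraph (2 + 2)).Adj (σ i) (σ j) ↔ adjOfUpper a b c d e f i j := by
  decide +kernel

theorem UniversallySolvable.iso_path_or_cycle {G : SimpleGraph (Fin 4)}
    (hG : UniversallySolvable G) (hadj : ∀ i, ∃ j, G.Adj i j) :
    Nonempty (G ≃g SimpleGraph.pathGraph 4) ∨ Nonempty (G ≃g SimpleGraph.cycleGraph 4) := by
  classical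
  obtain ⟨a, b, c, d, e, f, hA⟩ : ∃ a b c d e f, ∀ i j,
      G.Adj i j ↔ adjOfUpper a b c d e f i j := by
    refine ⟨G.Adj 0 1, G.Adj 0 2, G.Adj 0 3, G.Adj 1 2, G.Adj 1 3, G.Adj 2 3, fun i j ↦ ?_⟩
    fin_cases i <;> fin_cases j <;> simp [adjOfUpper] <;> exact G.adj_comm _ _
  rw [universallySolvable_iff_mulVec_eq_zero] at hG
  simp only [funext_iff, Matrix.mulVec, dotProduct, neighborhoodMatrix_apply, Pi.zero_apply,
    hA] at hG hadj
  refine (exists_perm_adjOfUpper a b c d e f ?_ hadj).imp ?_ ?_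
  · convert hG
  · exact fun ⟨σ, hσ⟩ ↦ ⟨σ, fun {i j} ↦ (hσ i j).trans (hA i j).symm⟩
  · exact fun ⟨σ, hσ⟩ ↦ ⟨σ, fun {i j} ↦ (hσ i j).trans (hA i j).symm⟩

/-- A connected simple graph on 4 vertices is universally solvable iff it is
isomorphic to the path graph on 4 vertices or to the cycle graph on 4 vertices. -/
theorem universallySolvable_iff_path_or_cycle
    {V : Type*} [Fintype V] (G : SimpleGraph V)
    (hV : Fintype.card V = 4) (hG : G.Connected) :
    UniversallySolvable G ↔
      Nonempty (G ≃g SimpleGraph.pathGraph 4) ∨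
        Nonempty (G ≃g SimpleGraph.cycleGraph 4) := by
  refine ⟨fun h ↦ ?_, ?_⟩
  · let e : G.overFin hV ≃g G := (G.overFinIso hV).symm
    have hadj (i : Fin 4) : ∃ j, (G.overFin hV).Adj i j :=
      (e.connected_iff.2 hG).preconnected.exists_adj_of_nontrivial i
    exact ((h.of_iso e).iso_path_or_cycle hadj).imp (.map e.symm.trans) (.map e.symm.trans)
  · rintro (⟨⟨e⟩⟩ | ⟨⟨e⟩⟩)
    · exact universallySolvable_pathGraph_four.of_iso e
    · exact universallySolvable_cycleGraph_four.of_iso e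
end

section
/- Let g be a permutation of {1,…,n} whose cycle type has exactly k_i cycles of length i for each 1 ≤ i ≤ n, and for each i let l(i) = Σ_{j : i ∣ j} k_j. Then the number c(g) of orbits of the induced action of g on the set of 2-element subsets of {1,…,n} satisfies c(g) = (1/2)·(Σ_{i=1}^{n} l(i)² φ(i) − l(1) + l(2)), where φ is the Euler totient function and l(2) is taken to be 0 when defined by an empty sum. -/
/-- The set `P` of 2-element subsets of the vertex set `{1, …, n}`. -/
abbrev Pairs (n : ℕ) : Type := {s : Finset (Fin n) // s.card = 2}

instance permPairsSMul (n : ℕ) : SMul (Equiv.Perm (Fin n)) (Pairs n) :=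
  ⟨fun g s => ⟨s.1.image g, by
    rw [Finset.card_image_of_injective _ g.injective]; exact s.2⟩⟩

/-- The action of permutations of `{1, …, n}` on 2-element subsets,
`g • {i, j} = {g i, g j}`. -/
instance permPairsAction (n : ℕ) : MulAction (Equiv.Perm (Fin n)) (Pairs n) where
  one_smul s := Subtype.ext (show s.1.image ⇑(1 : Equiv.Perm (Fin n)) = s.1 by simp)
  mul_smul g h s := Subtype.ext
    (show s.1.image ⇑(g * h) = (s.1.image ⇑h).image ⇑g by
      rw [Finset.image_image]; rfl)

open MulAction Finset in
/-- **Burnside's lemma** for the cyclic group generated by a single element. -/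
theorem sum_card_fixed_pow_eq {G X : Type*} [Group G] [Finite G] [MulAction G X] [Fintype X]
    [DecidableEq X] (g : G) :
    ∑ m ∈ range (orderOf g), #{x : X | g ^ m • x = x} =
      Nat.card (orbitRel.Quotient (Subgroup.zpowers g) X) * orderOf g := by
  classical
  have := Fintype.ofFinite G
  have hb := sum_card_fixedBy_eq_card_orbits_mul_card_group (Subgroup.zpowers g) X
  rw [Fintype.card_zpowers, ← Nat.card_eq_fintype_card] at hb
  refine Eq.trans ?_ hb
  rw [← (finEquivZPowers (isOfFinOrder_of_finite g)).sum_comp, ← Fin.sum_univ_eq_sum_range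
    (fun m => #{x : X | g ^ m • x = x})]
  refine Finset.sum_congr rfl fun m _ => ?_
  rw [Fintype.card_subtype]
  rfl

open MulAction Finset Function in
/-- The points of minimal period `d` under `g` form the orbits of length `d`. -/
theorem card_minimalPeriod_eq {G X : Type*} [Group G] [MulAction G X] [Fintype X] (g : G) (d : ℕ) :
    #{x : X | minimalPeriod (g • ·) x = d} =
      d * Nat.card {q : orbitRel.Quotient (Subgroup.zpowers g) X // Nat.card q.orbit = d} := by
  classical
  rw [Nat.card_eq_fintype_card, Fintype.card_subtype]
  have hp (x : X) : minimalPeriod (g • ·) x =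
      Nat.card (orbitRel.Quotient.orbit
        (Quotient.mk'' x : orbitRel.Quotient (Subgroup.zpowers g) X)) := by
    rw [orbitRel.Quotient.orbit_mk, Nat.card_eq_fintype_card, minimalPeriod_eq_card]
  rw [card_eq_sum_card_fiberwise (f := fun x => (Quotient.mk'' x :
    orbitRel.Quotient (Subgroup.zpowers g) X))
    (t := {q : orbitRel.Quotient (Subgroup.zpowers g) X | Nat.card q.orbit = d})]
  · rw [sum_const_nat (m := d), mul_comm]
    intro q hq
    rw [mem_filter_univ] at hq
    rw [← hq, Nat.card_eq_fintype_card, ← Set.toFinset_card]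
    congr 1
    ext x
    simp only [mem_filter, mem_univ, true_and, Set.mem_toFinset, orbitRel.Quotient.mem_orbit]
    refine and_iff_right_of_imp fun h => ?_
    rw [hp, h, Set.toFinset_card, Nat.card_eq_fintype_card]
  · intro x hx
    simpa only [coe_filter, mem_univ, true_and, Set.mem_ofPred_eq, hp] using hx

open MulAction Finset Function in
theorem sum_minimalPeriod_eq {G X : Type*} [Group G] [MulAction G X] [Fintype X]
    (g : G) (F : ℕ → ℕ) :
    ∑ x : X, F (minimalPeriod (g • ·) x) = ∑ d ∈ Icc 1 (Fintype.card X),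
      d * Nat.card {q : orbitRel.Quotient (Subgroup.zpowers g) X // Nat.card q.orbit = d} * F d := by
  classical
  rw [← sum_fiberwise_of_maps_to (s := univ) (t := Icc 1 (Fintype.card X))
    (g := fun x : X => minimalPeriod (g • ·) x)]
  · refine sum_congr rfl fun d _ => ?_
    rw [← card_minimalPeriod_eq, ← smul_eq_mul, ← sum_const]
    refine sum_congr rfl fun x hx => ?_
    rw [(mem_filter.1 hx).2]
  · intro x _
    rw [mem_Icc, minimalPeriod_eq_card]
    have : Nonempty (orbit (Subgroup.zpowers g) x) := (nonempty_orbit x).to_subtype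
    exact ⟨Fintype.card_pos, Fintype.card_subtype_le _⟩

open Finset in
theorem mul_card_range_dvd {N d : ℕ} (h : d ∣ N) : d * #{m ∈ range N | d ∣ m} = N := by
  obtain ⟨c, rfl⟩ := h
  rcases d.eq_zero_or_pos with rfl | hd
  · simp
  · have : {m ∈ range (d * c) | d ∣ m} = (range c).image (d * ·) := by
      ext m
      simp only [mem_filter, mem_range, mem_image]
      constructor
      · rintro ⟨hm, a, rfl⟩
        exact ⟨a, Nat.lt_of_mul_lt_mul_left hm, rfl⟩
      · rintro ⟨a, ha, rfl⟩
        exact ⟨Nat.mul_lt_mul_of_pos_left ha hd, dvd_mul_right ..⟩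
    rw [this, card_image_of_injective _ (mul_right_injective₀ hd.ne'), card_range]

open Finset in
theorem mul_mul_card_range_dvd_and_dvd {N d e : ℕ} (hd : d ∣ N) (he : e ∣ N) :
    d * e * #{m ∈ range N | d ∣ m ∧ e ∣ m} = N * d.gcd e := by
  simp_rw [← Nat.lcm_dvd_iff]
  rw [← Nat.gcd_mul_lcm d e, mul_assoc, mul_card_range_dvd (Nat.lcm_dvd hd he), mul_comm]

open Finset in
theorem mul_card_range_dvd_two_mul {N d : ℕ} (hd : d ∣ N) :
    d * #{m ∈ range N | d ∣ 2 * m} = N * (1 + if 2 ∣ d then 1 else 0) := by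
  split_ifs with h
  · obtain ⟨e, rfl⟩ := h
    simp_rw [Nat.mul_dvd_mul_iff_left two_pos]
    rw [mul_assoc, mul_card_range_dvd (dvd_of_mul_left_dvd hd), mul_comm]
  · have hc : d.Coprime 2 := ((Nat.Prime.coprime_iff_not_dvd Nat.prime_two).2 h).symm
    simp_rw [hc.dvd_mul_left]
    rw [mul_card_range_dvd hd, add_zero, mul_one]

open Finset in
theorem gcd_eq_sum_totient {n d : ℕ} (hd : d ∈ Icc 1 n) (e : ℕ) :
    d.gcd e = ∑ i ∈ Icc 1 n, if i ∣ d ∧ i ∣ e then i.totient else 0 := by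
  rw [mem_Icc] at hd
  rw [← sum_filter]
  conv_lhs => rw [← Nat.sum_totient (d.gcd e)]
  refine sum_congr ?_ fun _ _ => rfl
  ext i
  have : 0 < d.gcd e := Nat.gcd_pos_of_pos_left _ hd.1
  simp only [Nat.mem_divisors, Nat.dvd_gcd_iff, mem_filter, mem_Icc]
  constructor
  · rintro ⟨h, -⟩
    exact ⟨⟨Nat.pos_of_dvd_of_pos h.1 hd.1, (Nat.le_of_dvd hd.1 h.1).trans hd.2⟩, h⟩
  · rintro ⟨-, h⟩
    exact ⟨h, this.ne'⟩

open Finset in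
theorem sum_mul_mul_gcd (n : ℕ) (k : ℕ → ℕ) :
    ∑ d ∈ Icc 1 n, ∑ e ∈ Icc 1 n, k d * k e * d.gcd e =
      ∑ i ∈ Icc 1 n, (∑ j ∈ Icc 1 n, if i ∣ j then k j else 0) ^ 2 * i.totient := by
  have h : ∀ d ∈ Icc 1 n, ∀ e ∈ Icc 1 n, k d * k e * d.gcd e = ∑ i ∈ Icc 1 n,
      (if i ∣ d then k d else 0) * (if i ∣ e then k e else 0) * i.totient := by
    intro d hd e _
    rw [gcd_eq_sum_totient hd, mul_sum]
    refine sum_congr rfl fun i _ => ?_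
    by_cases h1 : i ∣ d <;> by_cases h2 : i ∣ e <;> simp [h1, h2]
  rw [sum_congr rfl fun d hd => sum_congr rfl (h d hd)]
  simp_rw [sq, sum_mul_sum, sum_mul]
  rw [sum_congr rfl fun d _ => sum_comm, sum_comm]

open Finset in
/-- Ordered pairs of distinct points whose underlying set is preserved by `h`. -/
theorem card_ordered_pairs_image_eq {n : ℕ} (h : Equiv.Perm (Fin n)) :
    #{p : Fin n × Fin n | p.1 ≠ p.2 ∧ ({p.1, p.2} : Finset (Fin n)).image h = {p.1, p.2}} =
      2 * #{s : Pairs n | h • s = s} := by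
  have hmem (s : Pairs n) : h • s = s ↔ s.1.image h = s.1 := Subtype.ext_iff
  rw [card_eq_sum_card_fiberwise (f := fun p => ({p.1, p.2} : Finset (Fin n)))
    (t := ({s : Pairs n | h • s = s} : Finset (Pairs n)).map (Function.Embedding.subtype _)),
    sum_const_nat (m := 2), card_map, mul_comm]
  · intro s hs
    simp only [mem_map, mem_filter_univ, Function.Embedding.subtype_apply, hmem] at hs
    obtain ⟨⟨s, h2⟩, hs, rfl⟩ := hs
    have : s.offDiag.card = 2 := by rw [offDiag_card, h2]
    refine Eq.trans ?_ this
    congr 1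
    obtain ⟨a, b, hab, rfl⟩ := card_eq_two.1 h2
    ext ⟨x, y⟩
    simp only [mem_filter, mem_univ, true_and, mem_offDiag]
    constructor
    · rintro ⟨⟨hne, -⟩, he⟩
      rw [← he]
      simp [hne]
    · rintro ⟨hx, hy, hne⟩
      have he : ({x, y} : Finset (Fin n)) = {a, b} := by
        simp only [mem_insert, mem_singleton] at hx hy
        ext z
        simp only [mem_insert, mem_singleton]
        grind
      exact ⟨⟨hne, he ▸ hs⟩, he⟩
  · rintro ⟨x, y⟩ hp
    simp only [coe_filter, mem_univ, true_and, Set.mem_ofPred_eq] at hp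
    simp only [coe_map, Set.mem_image, SetLike.mem_coe, mem_filter_univ, hmem]
    exact ⟨⟨{x, y}, card_pair hp.1⟩, hp.2, rfl⟩

open Finset in
theorem two_mul_card_fixed_pairs {n : ℕ} (h : Equiv.Perm (Fin n)) :
    2 * #{s : Pairs n | h • s = s} + 2 * #{x | h x = x} =
      #{x | h x = x} ^ 2 + #{x | h (h x) = x} := by
  have himg (x y : Fin n) (hne : x ≠ y) : ({x, y} : Finset (Fin n)).image h = {x, y} ↔
      (h x = x ∧ h y = y) ∨ (h x = y ∧ h y = x) := by
    rw [image_insert, image_singleton, ← coe_inj]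
    push_cast
    exact Set.pair_eq_pair_iff
  have hsplit : ({p : Fin n × Fin n | p.1 ≠ p.2 ∧
        ({p.1, p.2} : Finset (Fin n)).image h = {p.1, p.2}} : Finset (Fin n × Fin n)) =
      ({x | h x = x} : Finset (Fin n)).offDiag ∪
        (({x | h (h x) = x} : Finset (Fin n)) \ ({x | h x = x} : Finset (Fin n))).image
          fun x => (x, h x) := by
    ext ⟨x, y⟩
    simp only [mem_filter_univ, mem_union, mem_offDiag, mem_image, mem_sdiff, Prod.mk.injEq]
    constructor
    · rintro ⟨hne, hs⟩
      rw [himg x y hne] at hs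
      grind
    · rintro (⟨hx, hy, hne⟩ | ⟨z, ⟨hz, hne⟩, rfl, rfl⟩)
      · exact ⟨hne, (himg x y hne).2 (Or.inl ⟨hx, hy⟩)⟩
      · exact ⟨Ne.symm hne, (himg _ _ (Ne.symm hne)).2 (Or.inr ⟨rfl, hz⟩)⟩
  have hsub : ({x | h x = x} : Finset (Fin n)) ⊆ ({x | h (h x) = x} : Finset (Fin n)) := by
    intro x hx
    simp only [mem_filter_univ] at hx ⊢
    rw [hx, hx]
  have hc := card_ordered_pairs_image_eq h
  rw [hsplit, card_union_of_disjoint, offDiag_card,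
    card_image_of_injective _ fun x y hxy => congrArg Prod.fst hxy, card_sdiff_of_subset hsub] at hc
  · have h1 := card_le_card hsub
    have h2 := Nat.le_mul_self #{x | h x = x}
    rw [sq]
    lia
  · rw [disjoint_left]
    rintro ⟨x, y⟩ hx hy
    simp only [mem_offDiag, mem_image, mem_sdiff, mem_filter_univ, Prod.mk.injEq] at hx hy
    grind

open Finset in
/-- The fixed points of `g ^ m` are the points on cycles of `g` of length dividing `m`. -/
theorem card_fixed_pow {n : ℕ} (g : Equiv.Perm (Fin n)) (k : ℕ → ℕ)
    (hk : ∀ i, k i = Nat.card {q : MulAction.orbitRel.Quotient (Subgroup.zpowers g) (Fin n) //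
      Nat.card q.orbit = i}) (m : ℕ) :
    #{x | (g ^ m) x = x} = ∑ d ∈ Icc 1 n, if d ∣ m then d * k d else 0 := by
  have h := sum_minimalPeriod_eq g (X := Fin n) fun d => if d ∣ m then 1 else 0
  simp only [MulAction.pow_smul_eq_iff_minimalPeriod_dvd.symm, Fintype.card_fin, ← hk] at h
  rw [card_filter]
  refine h.trans (sum_congr rfl fun d _ => ?_)
  split_ifs <;> simp

theorem dvd_orderOf_of_ne_zero {n : ℕ} (g : Equiv.Perm (Fin n)) {d : ℕ}
    (h : Nat.card {q : MulAction.orbitRel.Quotient (Subgroup.zpowers g) (Fin n) //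
      Nat.card q.orbit = d} ≠ 0) : d ∣ orderOf g := by
  obtain ⟨⟨⟨q, hq⟩⟩, -⟩ := Nat.card_ne_zero.1 h
  induction q using Quotient.inductionOn' with | h x =>
  have := Fintype.ofFinite (MulAction.orbit (Subgroup.zpowers g) x)
  rw [MulAction.orbitRel.Quotient.orbit_mk, Nat.card_eq_fintype_card,
    ← MulAction.minimalPeriod_eq_card] at hq
  rw [← hq, ← MulAction.pow_smul_eq_iff_minimalPeriod_dvd, pow_orderOf_eq_one, one_smul]

open Finset in
/-- Let `g` be a permutation of `{1, …, n}` with exactly `k i` cycles of length `i` for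
each `1 ≤ i ≤ n` (the cycles of `g`, including fixed points as 1-cycles, are precisely
the orbits of `⟨g⟩` on `{1, …, n}`), and let `l i = Σ_{i ∣ j} k j`.  Then the number
`c(g)` of orbits of the induced action of `g` on 2-element subsets of `{1, …, n}`
satisfies `c(g) = (Σ_{i=1}^n l(i)² φ(i) − l(1) + l(2)) / 2`, stated here in the
subtraction-free form `2 c(g) + l(1) = Σ_{i=1}^n l(i)² φ(i) + l(2)`. -/
theorem card_pair_orbits_formula (n : ℕ) (g : Equiv.Perm (Fin n)) (k l : ℕ → ℕ)
    (hk : ∀ i, k i = Nat.card {q : MulAction.orbitRel.Quotient (Subgroup.zpowers g) (Fin n) //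
      Nat.card q.orbit = i})
    (hl : ∀ i, l i = ∑ j ∈ Finset.Icc 1 n, if i ∣ j then k j else 0) :
    2 * Nat.card (MulAction.orbitRel.Quotient (Subgroup.zpowers g) (Pairs n)) + l 1 =
      (∑ i ∈ Finset.Icc 1 n, l i ^ 2 * Nat.totient i) + l 2 := by
  have hN (d : ℕ) (hd : k d ≠ 0) : d ∣ orderOf g := dvd_orderOf_of_ne_zero g (hk d ▸ hd)
  have hfix (m : ℕ) := card_fixed_pow g k hk m
  have hpairs (m : ℕ) := two_mul_card_fixed_pairs (g ^ m)
  have hone : ∑ m ∈ range (orderOf g), #{x | (g ^ m) x = x} = orderOf g * l 1 := by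
    simp_rw [hfix]
    rw [sum_comm, hl, mul_sum]
    refine sum_congr rfl fun d _ => ?_
    rw [← sum_filter, sum_const, smul_eq_mul, if_pos (one_dvd d)]
    rcases eq_or_ne (k d) 0 with h0 | h0
    · simp [h0]
    · linear_combination k d * mul_card_range_dvd (hN d h0)
  have htwo : ∑ m ∈ range (orderOf g), #{x | (g ^ m) ((g ^ m) x) = x} =
      orderOf g * (l 1 + l 2) := by
    have h2 (m : ℕ) : #{x | (g ^ m) ((g ^ m) x) = x} =
        ∑ d ∈ Icc 1 n, if d ∣ 2 * m then d * k d else 0 := by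
      rw [← hfix, two_mul, pow_add]
      rfl
    simp_rw [h2]
    rw [sum_comm, hl, hl, ← sum_add_distrib, mul_sum]
    refine sum_congr rfl fun d _ => ?_
    rw [← sum_filter, sum_const, smul_eq_mul, if_pos (one_dvd d)]
    rcases eq_or_ne (k d) 0 with h0 | h0
    · simp [h0]
    · have := mul_card_range_dvd_two_mul (hN d h0)
      split_ifs at this ⊢ <;> linear_combination k d * this
  have hsq : ∑ m ∈ range (orderOf g), #{x | (g ^ m) x = x} ^ 2 =
      orderOf g * ∑ i ∈ Icc 1 n, l i ^ 2 * i.totient := by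
    simp_rw [hl, ← sum_mul_mul_gcd, hfix, sq, sum_mul_sum]
    rw [sum_comm, mul_sum]
    refine sum_congr rfl fun d _ => ?_
    rw [sum_comm, mul_sum]
    refine sum_congr rfl fun e _ => ?_
    rcases eq_or_ne (k d) 0 with h0 | h0
    · simp [h0]
    rcases eq_or_ne (k e) 0 with h0' | h0'
    · simp [h0']
    simp_rw [ite_zero_mul_ite_zero]
    rw [← sum_filter, sum_const, smul_eq_mul]
    linear_combination k d * k e * mul_mul_card_range_dvd_and_dvd (hN d h0) (hN e h0')
  have hb := sum_card_fixed_pow_eq (X := Pairs n) g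
  have hsum := sum_congr (rfl : range (orderOf g) = _) fun m _ => hpairs m
  simp only [sum_add_distrib, ← mul_sum] at hsum
  rw [hone, htwo, hsq, hb] at hsum
  refine Nat.eq_of_mul_eq_mul_left (orderOf_pos g) ?_
  linarith
end
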